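/- Let P ⊂ ℝ^d be a d-dimensional belt polytope with lattice of flats L(P) (with maximum 1̂ = ℝ^d) and let α be any cone angle on ℝ^d. Then for any fixed flat L ∈ L(P): Σ_F α̂(F,P) = (−1)^{d − dim L} μ_{L(P)}(L, 1̂), where the sum is over all faces F of P with L(F) = L and μ_{L(P)} is the Möbius function of L(P). -/

import Mathlib

open scoped BigOperators InnerProductSpace Pointwise

noncomputable section

/-- Euclidean space `ℝ^d`. -/
abbrev Euc (d : ℕ) : Type := EuclideanSpace ℝ (Fin d)

namespace GramAngles

variable {d : ℕ}

/-- The conical (positive) hull of a set. -/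
def posHull (S : Set (Euc d)) : Set (Euc d) :=
  {u | ∃ c : ℝ, ∃ p ∈ S, 0 ≤ c ∧ u = c • p}

/-- The dimension of a set: the rank of the linear subspace parallel to its affine hull. -/
def sdim (S : Set (Euc d)) : ℕ := Module.finrank ℝ (vectorSpan ℝ S)

/-- A polyhedral cone with apex at the origin: a finitely generated convex cone. -/
def IsPolyhedralCone (C : Set (Euc d)) : Prop :=
  ∃ (n : ℕ) (v : Fin n → Euc d),
    C = {x | ∃ c : Fin n → ℝ, (∀ i, 0 ≤ c i) ∧ x = ∑ i, c i • v i}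

/-- A cone angle on `ℝ^d`: a simple, normalized valuation on polyhedral cones. -/
structure ConeAngle (d : ℕ) where
  toFun : Set (Euc d) → ℝ
  zero' : toFun {0} = 0
  union' : ∀ C C' : Set (Euc d), IsPolyhedralCone C → IsPolyhedralCone C' →
    IsPolyhedralCone (C ∪ C') → IsPolyhedralCone (C ∩ C') →
    toFun (C ∪ C') = toFun C + toFun C' - toFun (C ∩ C')
  simple' : ∀ C : Set (Euc d), IsPolyhedralCone C → sdim C < d → toFun C = 0
  norm' : toFun Set.univ = 1

/-- A (convex) polytope: the convex hull of a nonempty finite point set. -/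
def IsPolytope (P : Set (Euc d)) : Prop :=
  ∃ s : Finset (Euc d), s.Nonempty ∧ P = convexHull ℝ (s : Set (Euc d))

/-- Faces of a polytope are its exposed subsets (including `∅` and `P` itself). -/
def IsFace (P F : Set (Euc d)) : Prop := IsExposed ℝ P F

open Classical in
/-- A chosen point in the relative interior of `F`. -/
def relPt (F : Set (Euc d)) : Euc d :=
  if h : (intrinsicInterior ℝ F).Nonempty then h.some else 0

/-- The tangent (inner) cone `T_F G = cone(-q + G) + L(G)^⊥`, `q ∈ relint F`. -/
def innerCone (F G : Set (Euc d)) : Set (Euc d) :=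
  posHull ((fun x => x - relPt F) '' G) + (((vectorSpan ℝ G)ᗮ : Submodule ℝ (Euc d)) : Set (Euc d))

/-- The normal cone `N_F G` of `G` at a face `F`. -/
def normalCone (F G : Set (Euc d)) : Set (Euc d) :=
  {c | ∀ x ∈ F, ∀ y ∈ G, ⟪c, y⟫_ℝ ≤ ⟪c, x⟫_ℝ}

/-- The outer cone `O_F G = N_F G + L(F)`. -/
def outerCone (F G : Set (Euc d)) : Set (Euc d) :=
  normalCone F G + ((vectorSpan ℝ F : Submodule ℝ (Euc d)) : Set (Euc d))

/-- Interior angle of `G` at its face `F`, measured by the cone angle `α`. -/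
def intAngle (α : ConeAngle d) (F G : Set (Euc d)) : ℝ := α.toFun (innerCone F G)

/-- Exterior angle of `G` at its face `F`, measured by the cone angle `α`. -/
def extAngle (α : ConeAngle d) (F G : Set (Euc d)) : ℝ := α.toFun (outerCone F G)

/-- `α̂_i(P)`: sum of interior angles over all `i`-dimensional (nonempty) faces of `P`. -/
def intAngleSum (α : ConeAngle d) (P : Set (Euc d)) (i : ℕ) : ℝ :=
  ∑ᶠ F ∈ {F : Set (Euc d) | IsFace P F ∧ F.Nonempty ∧ sdim F = i}, intAngle α F P

/-- `α̌_i(P)`: sum of exterior angles over all `i`-dimensional (nonempty) faces of `P`. -/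
def extAngleSum (α : ConeAngle d) (P : Set (Euc d)) (i : ℕ) : ℝ :=
  ∑ᶠ F ∈ {F : Set (Euc d) | IsFace P F ∧ F.Nonempty ∧ sdim F = i}, extAngle α F P

/-- A zonotope: a translate of a Minkowski sum of finitely many segments. -/
def IsZonotope (Z : Set (Euc d)) : Prop :=
  ∃ (t : Euc d) (n : ℕ) (z : Fin n → Euc d),
    Z = {x | ∃ l : Fin n → ℝ, (∀ i, |l i| ≤ 1) ∧ x = t + ∑ i, l i • z i}

/-- The face of `P` on which the linear functional `⟪c, ·⟫` is maximized. -/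
def maxFace (P : Set (Euc d)) (c : Euc d) : Set (Euc d) :=
  {x ∈ P | ∀ y ∈ P, ⟪c, y⟫_ℝ ≤ ⟪c, x⟫_ℝ}

/-- A belt polytope: a polytope whose normal fan is the fan induced by a central
hyperplane arrangement (two functionals maximize the same face iff they have the
same sign pattern with respect to the arrangement). -/
def IsBeltPolytope (P : Set (Euc d)) : Prop :=
  IsPolytope P ∧ ∃ (k : ℕ) (z : Fin k → Euc d), (∀ i, z i ≠ 0) ∧
    ∀ c c' : Euc d,
      ((∀ i, Real.sign ⟪z i, c⟫_ℝ = Real.sign ⟪z i, c'⟫_ℝ) ↔ maxFace P c = maxFace P c')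

/-- The set of flats of a polytope: linear subspaces parallel to nonempty faces,
ordered by inclusion (as a subtype of `Submodule ℝ (Euc d)`). -/
def Flats (P : Set (Euc d)) : Set (Submodule ℝ (Euc d)) :=
  {L | ∃ F : Set (Euc d), IsFace P F ∧ F.Nonempty ∧ L = vectorSpan ℝ F}

/-- Strictly increasing chains from `a` to `c` in a poset, encoded as lists. -/
def chainsFromTo {β : Type*} [Preorder β] (a c : β) : Set (List β) :=
  {l | l.Chain' (· < ·) ∧ l.head? = some a ∧ l.getLast? = some c}

/-- The Möbius function of a poset, via Philip Hall's chain formula. -/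
def mob {β : Type*} [Preorder β] (a c : β) : ℝ :=
  ∑ᶠ l ∈ chainsFromTo a c, (-1 : ℝ) ^ (l.length + 1)

/-- Whitney numbers of the first kind of a ranked poset with minimum `bot`. -/
def whitney1 {β : Type*} [Preorder β] (rk : β → ℕ) (bot : β) (i : ℕ) : ℝ :=
  ∑ᶠ a ∈ {a : β | rk a = i}, mob bot a

/-- Flag-Whitney numbers of the second kind: the number of chains with rank set `S`. -/
def flagW2 {β : Type*} [Preorder β] (rk : β → ℕ) (S : Finset ℕ) : ℕ :=
  Nat.card {l : List β // l.Chain' (· < ·) ∧ l.map rk = S.sort (· ≤ ·)}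

/-- Flag-Whitney numbers of the first kind:
`w_S = Σ μ(0̂,c₁) μ(c₁,c₂) ⋯ μ(c_{k-1},c_k)` over chains with rank set `S`. -/
def flagW1 {β : Type*} [Preorder β] (rk : β → ℕ) (bot : β) (S : Finset ℕ) : ℝ :=
  ∑ᶠ l ∈ {l : List β | l.Chain' (· < ·) ∧ l.map rk = S.sort (· ≤ ·)},
    (List.zipWith mob (bot :: l) l).prod

/-- Chains of nonempty faces of `P` whose dimensions are exactly the set `S`. -/
def faceChains (P : Set (Euc d)) (S : Finset ℕ) : Set (List (Set (Euc d))) :=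
  {l | (∀ F ∈ l, IsFace P F ∧ F.Nonempty) ∧ l.Chain' (· ⊂ ·) ∧ l.map sdim = S.sort (· ≤ ·)}

/-- The interior flag-angle `α̂_S(P) = Σ α̂(F₁,F₂) α̂(F₂,F₃) ⋯ α̂(F_k,P)`. -/
def intFlag (α : ConeAngle d) (P : Set (Euc d)) (S : Finset ℕ) : ℝ :=
  ∑ᶠ l ∈ faceChains P S, (List.zipWith (intAngle α) l (l.drop 1 ++ [P])).prod

/-- The exterior flag-angle `α̌_S(P) = Σ α̌(F₁,F₂) α̌(F₂,F₃) ⋯ α̌(F_k,P)`. -/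
def extFlag (α : ConeAngle d) (P : Set (Euc d)) (S : Finset ℕ) : ℝ :=
  ∑ᶠ l ∈ faceChains P S, (List.zipWith (extAngle α) l (l.drop 1 ++ [P])).prod

/-- Membership in the incidence algebra: vanishing off the order relation. -/
def memIA {β : Type*} [Preorder β] (h : β → β → ℝ) : Prop :=
  ∀ a c, ¬ a ≤ c → h a c = 0

/-- Convolution product of the incidence algebra. -/
def conv {β : Type*} [Preorder β] (g h : β → β → ℝ) (a c : β) : ℝ :=
  ∑ᶠ (b : β) (_ : a ≤ b ∧ b ≤ c), g a b * h b c

/-- The product `∗_k`, summing over middle elements of rank `k`. -/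
def convk {β : Type*} (rk : β → ℕ) (k : ℕ) (g h : β → β → ℝ) (a c : β) : ℝ :=
  ∑ᶠ (b : β) (_ : rk b = k), g a b * h b c

/-- The pushforward `φ_* h (q,q') = |φ⁻¹(q')|⁻¹ Σ_{p ∈ φ⁻¹(q), p' ∈ φ⁻¹(q')} h(p,p')`. -/
def pushf {β γ : Type*} (φ : β → γ) (h : β → β → ℝ) (q q' : γ) : ℝ :=
  (Nat.card {p : β // φ p = q'} : ℝ)⁻¹ *
    ∑ᶠ (p : β) (_ : φ p = q) (p' : β) (_ : φ p' = q'), h p p'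

/-- The subspace `I_φ(𝒫)`: elements whose fiberwise column sums are independent of
the representative of the target fiber. -/
def memIphi {β γ : Type*} [Preorder β] (φ : β → γ) (h : β → β → ℝ) : Prop :=
  memIA h ∧ ∀ (q : γ) (p₁ p₂ : β), φ p₁ = φ p₂ →
    (∑ᶠ (p : β) (_ : φ p = q), h p p₁) = (∑ᶠ (p : β) (_ : φ p = q), h p p₂)

open Classical in
/-- The pullback `φ^* g (p,p') = g(φ p, φ p')` for `p ≤ p'`, else `0`. -/
def pullb {β γ : Type*} [Preorder β] (φ : β → γ) (g : γ → γ → ℝ) (p p' : β) : ℝ :=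
  if p ≤ p' then g (φ p) (φ p') else 0

open Classical in
/-- The identity `δ` of the incidence algebra. -/
def deltaIA {β : Type*} (a c : β) : ℝ := if a = c then 1 else 0

end GramAngles

namespace GramAngles

/-- H-cone. -/
def Hc {d : ℕ} (G : Finset (Euc d)) : Set (Euc d) := {x | ∀ g ∈ G, ⟪g, x⟫_ℝ ≤ 0}

/-- V-cone -/
def Vc {d n : ℕ} (v : Fin n → Euc d) : Set (Euc d) :=
  {x | ∃ c : Fin n → ℝ, (∀ i, 0 ≤ c i) ∧ x = ∑ i, c i • v i}

lemma real_between (S T : Finset ℝ) (h : ∀ s ∈ S, ∀ t ∈ T, s ≤ t) (h0 : ∀ t ∈ T, 0 ≤ t) :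
    ∃ r : ℝ, 0 ≤ r ∧ (∀ s ∈ S, s ≤ r) ∧ ∀ t ∈ T, r ≤ t := by
  classical
  refine ⟨(insert 0 S).max' (by simp), Finset.le_max' _ _ (by simp),
    fun s hs => Finset.le_max' _ _ (by simp [hs]), fun t ht => ?_⟩
  apply Finset.max'_le
  intro y hy
  rcases Finset.mem_insert.1 hy with rfl | hy
  · exact h0 t ht
  · exact h y hy t ht

lemma fm_step {d : ℕ} (G : Finset (Euc d)) (v : Euc d) :
    ∃ G' : Finset (Euc d), Hc G' = {x | ∃ t : ℝ, 0 ≤ t ∧ x - t • v ∈ Hc G} := by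
  classical
  refine ⟨G.filter (fun g => ⟪g, v⟫_ℝ ≤ 0) ∪
    ((G ×ˢ G).filter (fun p => 0 < ⟪p.1, v⟫_ℝ ∧ ⟪p.2, v⟫_ℝ < 0)).image
      (fun p => ⟪p.1, v⟫_ℝ • p.2 - ⟪p.2, v⟫_ℝ • p.1), ?_⟩
  ext x
  constructor
  · intro hx
    obtain ⟨r, hr0, hr1, hr2⟩ := real_between
      ((G.filter (fun g => 0 < ⟪g, v⟫_ℝ)).image (fun g => ⟪g, x⟫_ℝ / ⟪g, v⟫_ℝ))
      ((G.filter (fun g => ⟪g, v⟫_ℝ < 0)).image (fun g => ⟪g, x⟫_ℝ / ⟪g, v⟫_ℝ))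
      (by
        intro s hs t ht
        simp only [Finset.mem_image, Finset.mem_filter] at hs ht
        obtain ⟨p, ⟨hp, hpv⟩, rfl⟩ := hs
        obtain ⟨n, ⟨hn, hnv⟩, rfl⟩ := ht
        have := hx (⟪p, v⟫_ℝ • n - ⟪n, v⟫_ℝ • p) (by
          apply Finset.mem_union_right
          simp only [Finset.mem_image, Finset.mem_filter, Finset.mem_product]
          exact ⟨(p, n), ⟨⟨hp, hn⟩, hpv, hnv⟩, rfl⟩)
        rw [inner_sub_left, real_inner_smul_left, real_inner_smul_left] at this
        rw [← neg_div_neg_eq ⟪n, x⟫_ℝ, div_le_div_iff₀ hpv (by linarith)]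
        nlinarith)
      (by
        intro t ht
        simp only [Finset.mem_image, Finset.mem_filter] at ht
        obtain ⟨n, ⟨hn, hnv⟩, rfl⟩ := ht
        have := hx n (by
          apply Finset.mem_union_left
          simp only [Finset.mem_filter]
          exact ⟨hn, hnv.le⟩)
        exact div_nonneg_of_nonpos this hnv.le)
    refine ⟨r, hr0, fun g hg => ?_⟩
    rw [inner_sub_right, real_inner_smul_right]
    rcases lt_trichotomy ⟪g, v⟫_ℝ 0 with h | h | h
    · have := hr2 _ (Finset.mem_image_of_mem _ (Finset.mem_filter.2 ⟨hg, h⟩))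
      rw [le_div_iff_of_neg h] at this
      linarith
    · have := hx g (Finset.mem_union_left _ (Finset.mem_filter.2 ⟨hg, h.le⟩))
      rw [h]; linarith
    · have := hr1 _ (Finset.mem_image_of_mem _ (Finset.mem_filter.2 ⟨hg, h⟩))
      rw [div_le_iff₀ h] at this
      linarith
  · rintro ⟨t, ht, hx⟩ g hg
    rcases Finset.mem_union.1 hg with hg | hg
    · obtain ⟨hg, h⟩ := Finset.mem_filter.1 hg
      have := hx g hg
      rw [inner_sub_right, real_inner_smul_right] at this
      nlinarith
    · simp only [Finset.mem_image, Finset.mem_filter, Finset.mem_product] at hg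
      obtain ⟨⟨p, n⟩, ⟨⟨hp, hn⟩, hpv, hnv⟩, rfl⟩ := hg
      have h1 := hx p hp
      have h2 := hx n hn
      simp only at hpv hnv
      rw [inner_sub_right, real_inner_smul_right] at h1 h2
      rw [inner_sub_left, real_inner_smul_left, real_inner_smul_left]
      nlinarith

lemma Hc_zero {d : ℕ} : ∃ G : Finset (Euc d), Hc G = {0} := by
  classical
  let b := EuclideanSpace.basisFun (Fin d) ℝ
  refine ⟨Finset.univ.image (fun i => b i) ∪ Finset.univ.image (fun i => - b i), ?_⟩
  ext x
  constructor
  · intro hx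
    ext i
    have h1 := hx (b i) (by simp)
    have h2 := hx (-b i) (by simp)
    rw [inner_neg_left] at h2
    have h3 : ⟪b i, x⟫_ℝ = x i := by
      simp [b, EuclideanSpace.inner_single_left]
    rw [h3] at h1 h2
    simp only [PiLp.zero_apply]
    linarith
  · rintro rfl g hg
    simp

/-- Weyl. -/
lemma weyl {d : ℕ} : ∀ (n : ℕ) (v : Fin n → Euc d), ∃ G : Finset (Euc d), Hc G = Vc v := by
  intro n
  induction n with
  | zero =>
    intro v
    obtain ⟨G, hG⟩ := Hc_zero (d := d)
    refine ⟨G, hG.trans ?_⟩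
    ext x
    simp [Vc]
  | succ n ih =>
    intro v
    obtain ⟨G, hG⟩ := ih (fun i => v i.succ)
    obtain ⟨G', hG'⟩ := fm_step G (v 0)
    refine ⟨G', hG'.trans ?_⟩
    rw [hG]
    ext x
    constructor
    · rintro ⟨t, ht, c, hc, hx⟩
      refine ⟨Fin.cons t c, ?_, ?_⟩
      · intro i
        refine Fin.cases ht hc i
      · rw [Fin.sum_univ_succ]
        simp only [Fin.cons_zero, Fin.cons_succ]
        rw [← hx]; abel
    · rintro ⟨c, hc, hx⟩
      refine ⟨c 0, hc 0, fun i => c i.succ, fun i => hc _, ?_⟩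
      rw [hx, Fin.sum_univ_succ]; abel

/-- Minkowski. -/
lemma isPolyhedralCone_Hc {d : ℕ} (G : Finset (Euc d)) : IsPolyhedralCone (Hc G) := by
  classical
  let g : Fin G.card → Euc d := fun i => (G.equivFin.symm i).1
  have hg : ∀ y ∈ G, ∃ i, g i = y := fun y hy => ⟨G.equivFin ⟨y, hy⟩, by simp [g]⟩
  have hg' : ∀ i, g i ∈ G := fun i => (G.equivFin.symm i).2
  obtain ⟨K, hK⟩ := weyl _ g
  let h : Fin K.card → Euc d := fun i => (K.equivFin.symm i).1
  have hh : ∀ y ∈ K, ∃ i, h i = y := fun y hy => ⟨K.equivFin ⟨y, hy⟩, by simp [h]⟩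
  have hh' : ∀ i, h i ∈ K := fun i => (K.equivFin.symm i).2
  obtain ⟨M, hM⟩ := weyl _ h
  refine ⟨K.card, h, ?_⟩
  change Hc G = Vc h
  have single : ∀ {n : ℕ} (v : Fin n → Euc d) (i : Fin n), v i ∈ Vc v := by
    intro n v i
    refine ⟨Pi.single i 1, fun j => ?_, ?_⟩
    · by_cases hj : j = i
      · subst hj; simp
      · simp [hj]
    · rw [Finset.sum_eq_single i] <;> simp +contextual
  ext x
  constructor
  · intro hx
    rw [← hM]
    intro f hf
    have hfD : f ∈ Vc g := by
      rw [← hK]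
      intro k hk
      obtain ⟨i, rfl⟩ := hh k hk
      have : h i ∈ Hc M := hM ▸ single h i
      rw [real_inner_comm]
      exact this f hf
    obtain ⟨c, hc, rfl⟩ := hfD
    rw [sum_inner]
    apply Finset.sum_nonpos
    intro i _
    rw [real_inner_smul_left]
    exact mul_nonpos_of_nonneg_of_nonpos (hc i) (hx _ (hg' i))
  · rintro ⟨c, hc, rfl⟩ y hy
    obtain ⟨j, rfl⟩ := hg y hy
    rw [inner_sum]
    apply Finset.sum_nonpos
    intro i _
    rw [real_inner_smul_right]
    have : g j ∈ Hc K := hK ▸ single g j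
    rw [real_inner_comm]
    exact mul_nonpos_of_nonneg_of_nonpos (hc i) (this _ (hh' i))

lemma IsPolyhedralCone.exists_Hc {d : ℕ} {C : Set (Euc d)} (h : IsPolyhedralCone C) :
    ∃ G : Finset (Euc d), C = Hc G := by
  obtain ⟨n, v, rfl⟩ := h
  obtain ⟨G, hG⟩ := weyl n v
  exact ⟨G, hG.symm⟩

lemma convex_Hc {d : ℕ} (G : Finset (Euc d)) : Convex ℝ (Hc G) := by
  intro x hx y hy a b ha hb _ g hg
  rw [inner_add_right, real_inner_smul_right, real_inner_smul_right]
  have h1 := hx g hg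
  have h2 := hy g hg
  nlinarith

lemma zero_mem_Hc {d : ℕ} (G : Finset (Euc d)) : (0 : Euc d) ∈ Hc G := by
  intro g _
  simp

lemma sdim_lt_of_subset {d : ℕ} {C : Set (Euc d)} {a : Euc d} (ha : a ≠ 0)
    (hC : ∀ x ∈ C, ⟪a, x⟫_ℝ = 0) : sdim C < d := by
  unfold sdim
  have h1 : vectorSpan ℝ C ≤ (ℝ ∙ a)ᗮ := by
    rw [vectorSpan_def, Submodule.span_le]
    rintro _ ⟨x, hx, y, hy, rfl⟩
    simp only [SetLike.mem_coe, Submodule.mem_orthogonal_singleton_iff_inner_right, vsub_eq_sub,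
      inner_sub_right, hC x hx, hC y hy, sub_zero]
  have h2 : (ℝ ∙ a)ᗮ < ⊤ := by
    rw [lt_top_iff_ne_top]
    intro h
    have : a ∈ (ℝ ∙ a)ᗮ := h ▸ Submodule.mem_top
    rw [Submodule.mem_orthogonal_singleton_iff_inner_right, inner_self_eq_zero] at this
    exact ha this
  have h3 := Submodule.finrank_lt h2.ne
  have h4 := Submodule.finrank_mono h1
  simp only [finrank_euclideanSpace, Fintype.card_fin] at h3
  omega

lemma interior_nonempty_of_sdim {d : ℕ} {C : Set (Euc d)} (hc : Convex ℝ C) (hne : C.Nonempty)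
    (h : ¬ sdim C < d) : (interior C).Nonempty := by
  rw [hc.interior_nonempty_iff_affineSpan_eq_top]
  rw [AffineSubspace.affineSpan_eq_top_iff_vectorSpan_eq_top_of_nonempty _ _ _ hne]
  apply Submodule.eq_top_of_finrank_eq
  have := Submodule.finrank_le (vectorSpan ℝ C)
  simp only [finrank_euclideanSpace, Fintype.card_fin] at this ⊢
  unfold sdim at h
  omega

lemma eventually_perturb {d : ℕ} {S : Set (Euc d)} {u : Euc d} (hS : S ∈ nhds u) (x : Euc d) :
    ∀ᶠ t : ℝ in nhds 0, u + t • x ∈ S := by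
  have : ContinuousAt (fun t : ℝ => u + t • x) 0 := by fun_prop
  apply this.eventually_mem
  simpa using hS

lemma exists_perturb {d : ℕ} {S : Set (Euc d)} {u : Euc d} (hS : S ∈ nhds u) (x : Euc d) :
    ∃ t : ℝ, 0 < t ∧ u + t • x ∈ S := by
  have h1 : ∀ᶠ t : ℝ in nhdsWithin 0 (Set.Ioi 0), u + t • x ∈ S :=
    (eventually_perturb hS x).filter_mono nhdsWithin_le_nhds
  obtain ⟨t, h, ht⟩ := (h1.and self_mem_nhdsWithin).exists
  exact ⟨t, ht, h⟩

lemma inner_neg_of_mem_interior {d : ℕ} {G : Finset (Euc d)} {a u : Euc d} (ha : a ≠ 0)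
    (hG : a ∈ G) (hu : u ∈ interior (Hc G)) : ⟪a, u⟫_ℝ < 0 := by
  obtain ⟨t, ht, h⟩ := exists_perturb (mem_interior_iff_mem_nhds.1 hu) a
  have := h a hG
  rw [inner_add_right, real_inner_smul_right] at this
  have h2 : 0 < ⟪a, a⟫_ℝ := real_inner_self_pos.2 ha
  nlinarith

lemma angle_cut {d : ℕ} (α : ConeAngle d) [DecidableEq (Euc d)] (G : Finset (Euc d)) {a : Euc d} (ha : a ≠ 0) :
    α.toFun (Hc G) = α.toFun (Hc (insert a G)) + α.toFun (Hc (insert (-a) G)) := by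
  have hu : Hc (insert a G) ∪ Hc (insert (-a) G) = Hc G := by
    ext x
    simp only [Hc, Finset.mem_insert, forall_eq_or_imp, Set.mem_union, Set.mem_ofPred_eq,
      inner_neg_left]
    constructor
    · rintro (h | h) <;> exact h.2
    · intro h
      rcases le_total ⟪a, x⟫_ℝ 0 with h' | h'
      · exact Or.inl ⟨h', h⟩
      · exact Or.inr ⟨by linarith, h⟩
  have hi : Hc (insert a G) ∩ Hc (insert (-a) G) = Hc (insert a (insert (-a) G)) := by
    ext x
    simp only [Hc, Finset.mem_insert, forall_eq_or_imp, Set.mem_inter_iff, Set.mem_ofPred_eq]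
    tauto
  have h := α.union' (Hc (insert a G)) (Hc (insert (-a) G)) (isPolyhedralCone_Hc _)
    (isPolyhedralCone_Hc _) (hu ▸ isPolyhedralCone_Hc _) (hi ▸ isPolyhedralCone_Hc _)
  have h0 : α.toFun (Hc (insert a (insert (-a) G))) = 0 := by
    apply α.simple' _ (isPolyhedralCone_Hc _)
    apply sdim_lt_of_subset ha
    intro x hx
    have h1 := hx a (by simp)
    have h2 := hx (-a) (by simp)
    rw [inner_neg_left] at h2
    linarith
  rw [hu, hi, h0] at h
  linarith

open Classical in
/-- Indicator function. -/
def ind {d : ℕ} (S : Set (Euc d)) (u : Euc d) : ℝ := if u ∈ S then 1 else 0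

open Classical in
lemma angle_rep {d : ℕ} (α : ConeAngle d) (A : Finset (Euc d)) : (∀ a ∈ A, a ≠ 0) →
    ∀ D : Finset (Euc d), ∃ (ι : Type) (_ : Fintype ι) (u : ι → Euc d) (w : ι → ℝ),
      (∀ i, u i ∈ interior (Hc D)) ∧ (∀ i, ∀ a ∈ A, ⟪a, u i⟫_ℝ ≠ 0) ∧
      ∀ B ⊆ A, α.toFun (Hc (D ∪ B)) = ∑ i, w i * ind (Hc B) (u i) := by
  induction A using Finset.induction_on with
  | empty =>
    intro _ D
    by_cases h : sdim (Hc D) < d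
    · refine ⟨Empty, inferInstance, Empty.elim, Empty.elim, fun i => i.elim, fun i => i.elim, ?_⟩
      intro B hB
      rw [Finset.subset_empty.1 hB, Finset.union_empty, α.simple' _ (isPolyhedralCone_Hc _) h]
      simp
    · obtain ⟨u, hu⟩ := interior_nonempty_of_sdim (convex_Hc D) ⟨0, zero_mem_Hc D⟩ h
      refine ⟨Unit, inferInstance, fun _ => u, fun _ => α.toFun (Hc D), fun _ => hu, by simp, ?_⟩
      intro B hB
      rw [Finset.subset_empty.1 hB, Finset.union_empty]
      simp [Hc, ind]
  | insert a A haA ih =>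
    intro hA D
    have ha : a ≠ 0 := hA a (by simp)
    have hA' : ∀ b ∈ A, b ≠ 0 := fun b hb => hA b (by simp [hb])
    obtain ⟨ι₁, _, u₁, w₁, hu₁, hg₁, hs₁⟩ := ih hA' (insert a D)
    obtain ⟨ι₂, _, u₂, w₂, hu₂, hg₂, hs₂⟩ := ih hA' (insert (-a) D)
    have hn₁ : ∀ i, ⟪a, u₁ i⟫_ℝ < 0 := fun i =>
      inner_neg_of_mem_interior ha (by simp) (hu₁ i)
    have hn₂ : ∀ i, 0 < ⟪a, u₂ i⟫_ℝ := fun i => by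
      have := inner_neg_of_mem_interior (neg_ne_zero.2 ha) (by simp) (hu₂ i)
      rw [inner_neg_left] at this
      linarith
    have hmono : ∀ b : Euc d, Hc (insert b D) ⊆ Hc D := fun b x hx g hg => hx g (by simp [hg])
    refine ⟨ι₁ ⊕ ι₂, inferInstance, Sum.elim u₁ u₂, Sum.elim w₁ w₂, ?_, ?_, ?_⟩
    · rintro (i | i)
      · exact interior_mono (hmono _) (hu₁ i)
      · exact interior_mono (hmono _) (hu₂ i)
    · rintro (i | i) b hb
      · rcases Finset.mem_insert.1 hb with rfl | hb
        · exact (hn₁ i).ne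
        · exact hg₁ i b hb
      · rcases Finset.mem_insert.1 hb with rfl | hb
        · exact (hn₂ i).ne'
        · exact hg₂ i b hb
    · intro B hB
      rw [Fintype.sum_sum_type]
      simp only [Sum.elim_inl, Sum.elim_inr]
      by_cases haB : a ∈ B
      · have hB' : B.erase a ⊆ A := by
          intro b hb
          rw [Finset.mem_erase] at hb
          exact (Finset.mem_insert.1 (hB hb.2)).resolve_left hb.1
        have e : D ∪ B = insert a D ∪ B.erase a := by
          rw [Finset.insert_union, ← Finset.union_insert, Finset.insert_erase haB]
        rw [e, hs₁ _ hB']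
        have z2 : ∑ i, w₂ i * ind (Hc B) (u₂ i) = 0 := by
          apply Finset.sum_eq_zero
          intro i _
          rw [ind, if_neg, mul_zero]
          intro h
          exact absurd (h a haB) (not_le.2 (hn₂ i))
        rw [z2, add_zero]
        apply Finset.sum_congr rfl
        intro i _
        congr 1
        have : u₁ i ∈ Hc (B.erase a) ↔ u₁ i ∈ Hc B := by
          constructor
          · intro h g hg
            by_cases hga : g = a
            · subst hga; exact (hn₁ i).le
            · exact h g (Finset.mem_erase.2 ⟨hga, hg⟩)
          · intro h g hg
            exact h g (Finset.mem_of_mem_erase hg)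
        simp only [ind, this]
      · have hB' : B ⊆ A := by
          intro b hb
          refine (Finset.mem_insert.1 (hB hb)).resolve_left ?_
          rintro rfl
          exact haB hb
        rw [angle_cut α (D ∪ B) ha, ← Finset.insert_union, ← Finset.insert_union, hs₁ _ hB',
          hs₂ _ hB']

/-- The subspace where all functionals with zero sign vanish. -/
def Wz {d k : ℕ} (z : Fin k → Euc d) (σ : Fin k → SignType) : Submodule ℝ (Euc d) :=
  ⨅ i, ⨅ (_ : σ i = 0), (ℝ ∙ z i)ᗮ

lemma mem_Wz {d k : ℕ} {z : Fin k → Euc d} {σ : Fin k → SignType} {x : Euc d} :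
    x ∈ Wz z σ ↔ ∀ i, σ i = 0 → ⟪z i, x⟫_ℝ = 0 := by
  simp [Wz, Submodule.mem_iInf, Submodule.mem_orthogonal_singleton_iff_inner_right]

lemma sum_signType (f : SignType → ℝ) : ∑ s, f s = f 0 + f (-1) + f 1 := by
  have : (Finset.univ : Finset SignType) = {0, -1, 1} := by decide
  rw [this, Finset.sum_insert (by decide), Finset.sum_insert (by decide), Finset.sum_singleton]
  ring

lemma finrank_inf_hyperplane {d : ℕ} (V : Submodule ℝ (Euc d)) (z x : Euc d) (hx : x ∈ V)
    (hz : ⟪z, x⟫_ℝ ≠ 0) :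
    Module.finrank ℝ V = Module.finrank ℝ ↥(V ⊓ (ℝ ∙ z)ᗮ) + 1 := by
  let f : V →ₗ[ℝ] ℝ := (innerₛₗ ℝ z).comp V.subtype
  have hf : Function.Surjective f := by
    apply LinearMap.surjective
    intro h
    apply hz
    have := congrArg (fun g => g ⟨x, hx⟩) h
    simpa [f] using this
  have h1 := f.finrank_range_add_finrank_ker
  rw [LinearMap.range_eq_top.2 hf, finrank_top, Module.finrank_self] at h1
  have h2 : (LinearMap.ker f).map V.subtype = V ⊓ (ℝ ∙ z)ᗮ := by
    ext y
    simp only [Submodule.mem_map, LinearMap.mem_ker, Submodule.mem_inf,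
      Submodule.mem_orthogonal_singleton_iff_inner_right]
    constructor
    · rintro ⟨y, hy, rfl⟩
      exact ⟨y.2, by simpa [f] using hy⟩
    · rintro ⟨hy, h⟩
      exact ⟨⟨y, hy⟩, by simpa [f] using h, rfl⟩
  have h3 := (Submodule.equivSubtypeMap V (LinearMap.ker f)).finrank_eq
  rw [← h2, ← h3]
  omega

open Classical in
/-- Euler relation for central arrangements cut by an open convex set. -/
lemma euler_arr {d : ℕ} : ∀ (k : ℕ) (z : Fin k → Euc d) (V : Submodule ℝ (Euc d)) (X : Set (Euc d)),
    IsOpen X → Convex ℝ X →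
    ∑ σ : Fin k → SignType, (if ∃ x ∈ V, x ∈ X ∧ ∀ i, SignType.sign ⟪z i, x⟫_ℝ = σ i then
      (-1 : ℝ) ^ Module.finrank ℝ ↥(V ⊓ Wz z σ) else 0) =
    if ∃ x ∈ V, x ∈ X then (-1 : ℝ) ^ Module.finrank ℝ V else 0 := by
  intro k
  induction k with
  | zero =>
    intro z V X _ _
    have : ∀ σ, Wz z σ = ⊤ := fun σ => by
      rw [eq_top_iff]; intro x _; rw [mem_Wz]; intro i; exact i.elim0
    rw [Fintype.sum_unique, this, inf_top_eq]
    simp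
  | succ k ih =>
    intro z V X hX hc
    let z' : Fin k → Euc d := fun i => z i.succ
    have hop : IsOpen {x : Euc d | 0 < ⟪z 0, x⟫_ℝ} :=
      isOpen_lt continuous_const (by fun_prop)
    have hon : IsOpen {x : Euc d | ⟪z 0, x⟫_ℝ < 0} :=
      isOpen_lt (by fun_prop) continuous_const
    have hcp : Convex ℝ {x : Euc d | 0 < ⟪z 0, x⟫_ℝ} :=
      convex_halfSpace_gt (innerₛₗ ℝ (z 0)).isLinear 0
    have hcn : Convex ℝ {x : Euc d | ⟪z 0, x⟫_ℝ < 0} :=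
      convex_halfSpace_lt (innerₛₗ ℝ (z 0)).isLinear 0
    have i0 := ih z' (V ⊓ (ℝ ∙ z 0)ᗮ) X hX hc
    have ip := ih z' V (X ∩ {x : Euc d | 0 < ⟪z 0, x⟫_ℝ}) (hX.inter hop) (hc.inter hcp)
    have im := ih z' V (X ∩ {x : Euc d | ⟪z 0, x⟫_ℝ < 0}) (hX.inter hon) (hc.inter hcn)
    rw [← (Fin.consEquiv (fun _ => SignType)).sum_comp, Fintype.sum_prod_type, sum_signType]
    have w0 : ∀ σ : Fin k → SignType, Wz z (Fin.cons 0 σ) = (ℝ ∙ z 0)ᗮ ⊓ Wz z' σ := by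
      intro σ
      ext x
      simp [mem_Wz, Fin.forall_fin_succ, z', Submodule.mem_orthogonal_singleton_iff_inner_right]
    have wn : ∀ (s : SignType) (σ : Fin k → SignType), s ≠ 0 →
        Wz z (Fin.cons s σ) = Wz z' σ := by
      intro s σ hs
      ext x
      simp [mem_Wz, Fin.forall_fin_succ, z', hs]
    have e0 : ∑ σ : Fin k → SignType, (if ∃ x ∈ V, x ∈ X ∧ ∀ i, SignType.sign ⟪z i, x⟫_ℝ =
        (Fin.consEquiv (fun _ => SignType)) (0, σ) i then
      (-1 : ℝ) ^ Module.finrank ℝ ↥(V ⊓ Wz z ((Fin.consEquiv (fun _ => SignType)) (0, σ))) else 0)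
        = if ∃ x ∈ V ⊓ (ℝ ∙ z 0)ᗮ, x ∈ X then
          (-1 : ℝ) ^ Module.finrank ℝ ↥(V ⊓ (ℝ ∙ z 0)ᗮ) else 0 := by
      rw [← i0]
      apply Finset.sum_congr rfl
      intro σ _
      congr 1
      · simp only [Fin.consEquiv_apply, Fin.forall_fin_succ, Fin.cons_zero, Fin.cons_succ,
          sign_eq_zero_iff, Submodule.mem_inf,
          Submodule.mem_orthogonal_singleton_iff_inner_right, z']
        apply propext
        constructor
        · rintro ⟨x, h1, h2, h3, h4⟩; exact ⟨x, ⟨h1, h3⟩, h2, h4⟩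
        · rintro ⟨x, ⟨h1, h3⟩, h2, h4⟩; exact ⟨x, h1, h2, h3, h4⟩
      · exact congrArg (fun W : Submodule ℝ (Euc d) => (-1 : ℝ) ^ Module.finrank ℝ W)
          (by rw [inf_assoc, ← w0]; rfl)
    have ep : ∑ σ : Fin k → SignType, (if ∃ x ∈ V, x ∈ X ∧ ∀ i, SignType.sign ⟪z i, x⟫_ℝ =
        (Fin.consEquiv (fun _ => SignType)) (1, σ) i then
      (-1 : ℝ) ^ Module.finrank ℝ ↥(V ⊓ Wz z ((Fin.consEquiv (fun _ => SignType)) (1, σ))) else 0)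
        = if ∃ x ∈ V, x ∈ X ∩ {x : Euc d | 0 < ⟪z 0, x⟫_ℝ} then
          (-1 : ℝ) ^ Module.finrank ℝ V else 0 := by
      rw [← ip]
      apply Finset.sum_congr rfl
      intro σ _
      congr 1
      · simp only [Fin.consEquiv_apply, Fin.forall_fin_succ, Fin.cons_zero, Fin.cons_succ,
          sign_eq_one_iff, Set.mem_inter_iff, Set.mem_ofPred_eq, and_assoc, z']
      · exact congrArg (fun W : Submodule ℝ (Euc d) => (-1 : ℝ) ^ Module.finrank ℝ W)
          (by rw [← wn 1 σ (by decide)]; rfl)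
    have em : ∑ σ : Fin k → SignType, (if ∃ x ∈ V, x ∈ X ∧ ∀ i, SignType.sign ⟪z i, x⟫_ℝ =
        (Fin.consEquiv (fun _ => SignType)) (-1, σ) i then
      (-1 : ℝ) ^ Module.finrank ℝ ↥(V ⊓ Wz z ((Fin.consEquiv (fun _ => SignType)) (-1, σ))) else 0)
        = if ∃ x ∈ V, x ∈ X ∩ {x : Euc d | ⟪z 0, x⟫_ℝ < 0} then
          (-1 : ℝ) ^ Module.finrank ℝ V else 0 := by
      rw [← im]
      apply Finset.sum_congr rfl
      intro σ _
      congr 1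
      · simp only [Fin.consEquiv_apply, Fin.forall_fin_succ, Fin.cons_zero, Fin.cons_succ,
          sign_eq_neg_one_iff, Set.mem_inter_iff, Set.mem_ofPred_eq, and_assoc, z']
      · exact congrArg (fun W : Submodule ℝ (Euc d) => (-1 : ℝ) ^ Module.finrank ℝ W)
          (by rw [← wn (-1) σ (by decide)]; rfl)
    rw [e0, em, ep]
    clear e0 em ep i0 ip im
    by_cases hv : ∀ x ∈ V, ⟪z 0, x⟫_ℝ = 0
    · have hV : V ⊓ (ℝ ∙ z 0)ᗮ = V := by
        rw [inf_eq_left]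
        intro x hx
        rw [Submodule.mem_orthogonal_singleton_iff_inner_right]
        exact hv x hx
      rw [hV, if_neg (c := ∃ x ∈ V, x ∈ X ∩ {x : Euc d | ⟪z 0, x⟫_ℝ < 0}),
        if_neg (c := ∃ x ∈ V, x ∈ X ∩ {x : Euc d | 0 < ⟪z 0, x⟫_ℝ})]
      · simp
      · rintro ⟨x, hx, _, h⟩
        simp [hv x hx] at h
      · rintro ⟨x, hx, _, h⟩
        simp [hv x hx] at h
    · push Not at hv
      obtain ⟨v, hvV, hvz⟩ := hv
      have hfr := finrank_inf_hyperplane V (z 0) v hvV hvz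
      by_cases h0 : ∃ x ∈ V ⊓ (ℝ ∙ z 0)ᗮ, x ∈ X
      · obtain ⟨x, hxV, hxX⟩ := h0
        obtain ⟨hxV', hxz⟩ := Submodule.mem_inf.1 hxV
        rw [Submodule.mem_orthogonal_singleton_iff_inner_right] at hxz
        have key : ∀ y ∈ V, ∃ t : ℝ, 0 < t ∧ x + t • y ∈ V ∧ x + t • y ∈ X ∧
            ⟪z 0, x + t • y⟫_ℝ = t * ⟪z 0, y⟫_ℝ := by
          intro y hy
          obtain ⟨t, ht, h⟩ := exists_perturb (hX.mem_nhds hxX) y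
          refine ⟨t, ht, V.add_mem hxV' (V.smul_mem _ hy), h, ?_⟩
          rw [inner_add_right, real_inner_smul_right, hxz, zero_add]
        have hp : ∃ y ∈ V, 0 < ⟪z 0, y⟫_ℝ := by
          rcases lt_or_gt_of_ne hvz with h | h
          · exact ⟨-v, V.neg_mem hvV, by rw [inner_neg_right]; linarith⟩
          · exact ⟨v, hvV, h⟩
        obtain ⟨y, hyV, hy⟩ := hp
        rw [if_pos ⟨x, hxV, hxX⟩, if_pos, if_pos, if_pos ⟨x, hxV', hxX⟩, hfr, pow_succ]
        · ring
        · obtain ⟨t, ht, h1, h2, h3⟩ := key y hyV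
          refine ⟨_, h1, h2, ?_⟩
          simp only [Set.mem_ofPred_eq, h3]; positivity
        · obtain ⟨t, ht, h1, h2, h3⟩ := key (-y) (V.neg_mem hyV)
          refine ⟨_, h1, h2, ?_⟩
          simp only [Set.mem_ofPred_eq, h3, inner_neg_right]
          nlinarith
      · rw [if_neg h0]
        have hne : ∀ x ∈ V, x ∈ X → ⟪z 0, x⟫_ℝ ≠ 0 := fun x hx hxX h => h0 ⟨x, Submodule.mem_inf.2
          ⟨hx, Submodule.mem_orthogonal_singleton_iff_inner_right.2 h⟩, hxX⟩
        by_cases hm : ∃ x ∈ V, x ∈ X ∩ {x : Euc d | ⟪z 0, x⟫_ℝ < 0}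
        · have hm' := hm
          obtain ⟨x, hxV, hxX, hx⟩ := hm
          rw [if_pos hm', if_neg, if_pos ⟨x, hxV, hxX⟩]
          · ring
          · rintro ⟨y, hyV, hyX, hy⟩
            simp only [Set.mem_ofPred_eq] at hx hy
            have hs : 0 < ⟪z 0, y⟫_ℝ - ⟪z 0, x⟫_ℝ := by linarith
            let a := ⟪z 0, y⟫_ℝ / (⟪z 0, y⟫_ℝ - ⟪z 0, x⟫_ℝ)
            let b := - ⟪z 0, x⟫_ℝ / (⟪z 0, y⟫_ℝ - ⟪z 0, x⟫_ℝ)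
            have hab : a + b = 1 := by simp only [a, b]; field_simp; ring
            refine hne (a • x + b • y) (V.add_mem (V.smul_mem _ hxV) (V.smul_mem _ hyV))
              (hc hxX hyX (div_nonneg hy.le hs.le) (div_nonneg (by linarith) hs.le) hab) ?_
            rw [inner_add_right, real_inner_smul_right, real_inner_smul_right]
            simp only [a, b]; field_simp; ring
        · rw [if_neg hm]
          have : (∃ x ∈ V, x ∈ X ∩ {x : Euc d | 0 < ⟪z 0, x⟫_ℝ}) ↔ ∃ x ∈ V, x ∈ X := by
            constructor
            · rintro ⟨x, hxV, hxX, _⟩; exact ⟨x, hxV, hxX⟩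
            · rintro ⟨x, hxV, hxX⟩
              refine ⟨x, hxV, hxX, ?_⟩
              rcases lt_or_gt_of_ne (hne x hxV hxX) with h | h
              · exact absurd ⟨x, hxV, hxX, h⟩ hm
              · exact h
          simp only [this]
          simp

lemma mem_chains {β : Type*} [Preorder β] {a c : β} {l : List β} :
    l ∈ chainsFromTo a c ↔ l.IsChain (· < ·) ∧ l.head? = some a ∧ l.getLast? = some c :=
  Iff.rfl

lemma chains_finite {β : Type*} [PartialOrder β] [Finite β] (a c : β) :
    (chainsFromTo a c).Finite := by
  classical
  have := Fintype.ofFinite β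
  apply (List.finite_length_le β (Fintype.card β)).subset
  intro l hl
  have h : l.Nodup := by
    have := (List.isChain_iff_pairwise.1 (mem_chains.1 hl).1)
    exact this.imp (fun h => h.ne)
  exact h.length_le_card

lemma mob_self {β : Type*} [PartialOrder β] (a : β) : mob a a = 1 := by
  have : chainsFromTo a a = {[a]} := by
    ext l
    rw [mem_chains, Set.mem_singleton_iff]
    constructor
    · rintro ⟨h1, h2, h3⟩
      match l, h1, h2, h3 with
      | [b], _, h2, _ => simpa using h2
      | b :: b' :: l, h1, h2, h3 =>
        exfalso
        have hb : b = a := by simpa using h2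
        subst hb
        have hp := List.isChain_iff_pairwise.1 h1
        rw [List.pairwise_cons] at hp
        have : b ∈ b' :: l := by
          rw [List.getLast?_cons_cons] at h3
          exact List.mem_of_getLast? h3
        exact lt_irrefl _ (hp.1 b this)
    · rintro rfl
      simp
  rw [mob, this, finsum_mem_singleton]
  simp

open Classical in
lemma mob_rec {β : Type*} [PartialOrder β] [Fintype β] (a c : β) (hac : a ≠ c) :
    mob a c = - ∑ b ∈ Finset.univ.filter (fun b => a < b), mob b c := by
  have e : chainsFromTo a c = ⋃ b ∈ {b : β | a < b}, (List.cons a) '' chainsFromTo b c := by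
    ext l
    simp only [Set.mem_iUnion, Set.mem_image, exists_prop, Set.mem_ofPred_eq]
    constructor
    · intro h
      obtain ⟨h1, h2, h3⟩ := mem_chains.1 h
      match l, h1, h2, h3 with
      | [b], _, h2, h3 =>
        simp at h2 h3
        exact absurd (h2.symm.trans h3) hac
      | b :: b' :: l, h1, h2, h3 =>
        have hb : b = a := by simpa using h2
        subst hb
        rw [List.isChain_cons_cons] at h1
        rw [List.getLast?_cons_cons] at h3
        exact ⟨b', h1.1, b' :: l, ⟨h1.2, by simp, h3⟩, rfl⟩
    · rintro ⟨b, hb, l, hl, rfl⟩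
      obtain ⟨h1, h2, h3⟩ := mem_chains.1 hl
      match l, h1, h2, h3 with
      | b' :: l, h1, h2, h3 =>
        have hb' : b' = b := by simpa using h2
        subst hb'
        refine ⟨List.isChain_cons_cons.2 ⟨hb, h1⟩, by simp, ?_⟩
        rw [List.getLast?_cons_cons]
        exact h3
  rw [mob, e, finsum_mem_biUnion _ (Set.toFinite _) (fun b _ => (chains_finite b c).image _)]
  · have : {b : β | a < b} = ((Finset.univ.filter (fun b => a < b) : Finset β) : Set β) := by
      ext; simp
    rw [this, finsum_mem_coe_finset, ← Finset.sum_neg_distrib]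
    apply Finset.sum_congr rfl
    intro b _
    rw [finsum_mem_image (List.cons_injective.injOn), mob,
      ← finsum_mem_neg_distrib _ (chains_finite b c)]
    apply finsum_mem_congr rfl
    intro l _
    rw [List.length_cons, pow_succ]
    ring
  · intro b _ b' _ hbb
    change Disjoint _ _
    rw [Set.disjoint_left]
    rintro _ ⟨l, hl, rfl⟩ ⟨l', hl', h⟩
    simp only [List.cons.injEq, true_and] at h
    subst h
    apply hbb
    have := (mem_chains.1 hl).2.1.symm.trans (mem_chains.1 hl').2.1
    simpa using this

open Classical in
lemma mob_unique {β : Type*} [PartialOrder β] [Fintype β] (c : β) (g : β → ℝ) (hc : g c = 1)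
    (hg : ∀ a, a ≠ c → ∑ b ∈ Finset.univ.filter (fun b => a ≤ b), g b = 0) (a : β) :
    g a = mob a c := by
  induction a using WellFoundedGT.induction with
  | ind a ih =>
    by_cases hac : a = c
    · subst hac; rw [hc, mob_self]
    · rw [mob_rec a c hac]
      have h := hg a hac
      have e : Finset.univ.filter (fun b => a ≤ b) =
          insert a (Finset.univ.filter (fun b => a < b)) := by
        ext b
        simp only [Finset.mem_filter, Finset.mem_univ, true_and, Finset.mem_insert]
        rw [le_iff_eq_or_lt, eq_comm]
      rw [e, Finset.sum_insert (by simp)] at h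
      have h2 : ∑ b ∈ Finset.univ.filter (fun b => a < b), mob b c =
          ∑ b ∈ Finset.univ.filter (fun b => a < b), g b := by
        apply Finset.sum_congr rfl
        intro b hb
        rw [ih b (Finset.mem_filter.1 hb).2]
      rw [h2]
      linarith

/-- Sign vector. -/
def sgn {d k : ℕ} (z : Fin k → Euc d) (c : Euc d) : Fin k → SignType :=
  fun i => SignType.sign ⟪z i, c⟫_ℝ

lemma real_sign_eq_iff (a b : ℝ) :
    Real.sign a = Real.sign b ↔ SignType.sign a = SignType.sign b := by
  rcases lt_trichotomy a 0 with ha | ha | ha <;> rcases lt_trichotomy b 0 with hb | hb | hb <;>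
    simp [ha, hb, Real.sign_of_neg, Real.sign_of_pos, sign_neg, sign_pos] <;> norm_num

lemma eventually_sign (a b : ℝ) : ∀ᶠ t : ℝ in nhdsWithin 0 (Set.Ioi 0),
    SignType.sign (a + t * b) = if a = 0 then SignType.sign b else SignType.sign a := by
  by_cases ha : a = 0
  · subst ha
    filter_upwards [self_mem_nhdsWithin] with t ht
    have ht' : (0 : ℝ) < t := ht
    simp [sign_mul, sign_pos ht']
  · have hc : ContinuousAt (fun t : ℝ => a + t * b) 0 := by fun_prop
    rw [if_neg ha]
    rcases lt_or_gt_of_ne ha with h | h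
    · have := (hc.eventually_lt continuousAt_const (by simpa using h) :
        ∀ᶠ t : ℝ in nhds 0, a + t * b < 0)
      filter_upwards [this.filter_mono nhdsWithin_le_nhds] with t ht
      rw [sign_neg ht, sign_neg h]
    · have := (continuousAt_const.eventually_lt hc (by simpa using h) :
        ∀ᶠ t : ℝ in nhds 0, 0 < a + t * b)
      filter_upwards [this.filter_mono nhdsWithin_le_nhds] with t ht
      rw [sign_pos ht, sign_pos h]

lemma eventually_sgn {d k : ℕ} (z : Fin k → Euc d) (c x : Euc d) :
    ∀ᶠ t : ℝ in nhdsWithin 0 (Set.Ioi 0), sgn z (c + t • x) =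
      fun i => if ⟪z i, c⟫_ℝ = 0 then SignType.sign ⟪z i, x⟫_ℝ else SignType.sign ⟪z i, c⟫_ℝ := by
  have : ∀ i, ∀ᶠ t : ℝ in nhdsWithin 0 (Set.Ioi 0), sgn z (c + t • x) i =
      if ⟪z i, c⟫_ℝ = 0 then SignType.sign ⟪z i, x⟫_ℝ else SignType.sign ⟪z i, c⟫_ℝ := by
    intro i
    filter_upwards [eventually_sign ⟪z i, c⟫_ℝ ⟪z i, x⟫_ℝ] with t ht
    rw [sgn, inner_add_right, real_inner_smul_right, ht]
  filter_upwards [Filter.eventually_all.2 this] with t ht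
  exact funext ht

lemma IsPolytope.compact {d : ℕ} {P : Set (Euc d)} (h : IsPolytope P) : IsCompact P := by
  obtain ⟨s, _, rfl⟩ := h
  exact s.finite_toSet.isCompact_convexHull ℝ

lemma IsPolytope.convex {d : ℕ} {P : Set (Euc d)} (h : IsPolytope P) : Convex ℝ P := by
  obtain ⟨s, _, rfl⟩ := h
  exact convex_convexHull ℝ _

lemma IsPolytope.nonempty {d : ℕ} {P : Set (Euc d)} (h : IsPolytope P) : P.Nonempty := by
  obtain ⟨s, hs, rfl⟩ := h
  exact hs.to_set.convexHull

lemma maxFace_nonempty {d : ℕ} {P : Set (Euc d)} (h : IsPolytope P) (c : Euc d) :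
    (maxFace P c).Nonempty := by
  obtain ⟨x, hx, hm⟩ := h.compact.exists_isMaxOn h.nonempty
    (f := fun y => ⟪c, y⟫_ℝ) (by fun_prop)
  exact ⟨x, hx, fun y hy => hm hy⟩

lemma maxFace_zero {d : ℕ} (P : Set (Euc d)) : maxFace P 0 = P := by
  ext x; simp [maxFace]

lemma maxFace_inner_eq {d : ℕ} {P : Set (Euc d)} {c p q : Euc d} (hp : p ∈ maxFace P c)
    (hq : q ∈ maxFace P c) : ⟪c, p⟫_ℝ = ⟪c, q⟫_ℝ :=
  le_antisymm (hq.2 p hp.1) (hp.2 q hq.1)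

lemma face_iff {d : ℕ} {P : Set (Euc d)} (h : IsPolytope P) (F : Set (Euc d)) :
    (IsFace P F ∧ F.Nonempty) ↔ ∃ c, F = maxFace P c := by
  constructor
  · rintro ⟨h1, h2⟩
    obtain ⟨l, hl⟩ := h1 h2
    refine ⟨(InnerProductSpace.toDual ℝ (Euc d)).symm l, ?_⟩
    rw [hl]
    ext x
    simp [maxFace]
  · rintro ⟨c, rfl⟩
    refine ⟨fun _ => ⟨innerSL ℝ c, ?_⟩, maxFace_nonempty h c⟩
    ext x
    simp [maxFace]

lemma maxFace_convex {d : ℕ} {P : Set (Euc d)} (h : Convex ℝ P) (c : Euc d) :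
    Convex ℝ (maxFace P c) := by
  intro x hx y hy a b ha hb hab
  refine ⟨h hx.1 hy.1 ha hb hab, fun w hw => ?_⟩
  rw [inner_add_right, real_inner_smul_right, real_inner_smul_right]
  have h1 := hx.2 w hw
  have h2 := hy.2 w hw
  have : ⟪c, w⟫_ℝ = a * ⟪c, w⟫_ℝ + b * ⟪c, w⟫_ℝ := by rw [← add_mul, hab, one_mul]
  nlinarith

lemma mem_vectorSpan_orth {d : ℕ} {F : Set (Euc d)} {x : Euc d} :
    x ∈ (vectorSpan ℝ F)ᗮ ↔ ∀ p ∈ F, ∀ q ∈ F, ⟪x, p⟫_ℝ = ⟪x, q⟫_ℝ := by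
  constructor
  · intro h p hp q hq
    have := Submodule.mem_orthogonal' _ _ |>.1 h (p -ᵥ q) (vsub_mem_vectorSpan ℝ hp hq)
    rw [vsub_eq_sub, inner_sub_right] at this
    linarith
  · intro h
    have : vectorSpan ℝ F ≤ (ℝ ∙ x)ᗮ := by
      rw [vectorSpan_def, Submodule.span_le]
      rintro _ ⟨p, hp, q, hq, rfl⟩
      simp only [SetLike.mem_coe, Submodule.mem_orthogonal_singleton_iff_inner_right, vsub_eq_sub,
        inner_sub_right, h p hp q hq, sub_self]
    rw [Submodule.mem_orthogonal']
    intro u hu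
    exact Submodule.mem_orthogonal_singleton_iff_inner_right.1 (this hu)

lemma self_mem_orth {d : ℕ} (P : Set (Euc d)) (c : Euc d) :
    c ∈ (vectorSpan ℝ (maxFace P c))ᗮ :=
  mem_vectorSpan_orth.2 fun _ hp _ hq => maxFace_inner_eq hp hq

/-- the belt property in terms of `sgn` -/
def Belt {d k : ℕ} (P : Set (Euc d)) (z : Fin k → Euc d) : Prop :=
  ∀ c c' : Euc d, sgn z c = sgn z c' ↔ maxFace P c = maxFace P c'

lemma orth_eq_Wz {d k : ℕ} {P : Set (Euc d)} {z : Fin k → Euc d} (hP : IsPolytope P)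
    (hb : Belt P z) (c : Euc d) : (vectorSpan ℝ (maxFace P c))ᗮ = Wz z (sgn z c) := by
  ext x
  rw [mem_Wz]
  constructor
  · intro hx
    rw [mem_vectorSpan_orth] at hx
    have ev := (eventually_sgn z c x).and (self_mem_nhdsWithin (a := (0 : ℝ)) (s := Set.Ioi 0))
    obtain ⟨t, hts, ht⟩ := ev.exists
    have ht0 : (0 : ℝ) < t := ht
    obtain ⟨p, hp⟩ := maxFace_nonempty hP (c + t • x)
    have hpc : p ∈ maxFace P c := by
      refine ⟨hp.1, fun y hy => ?_⟩
      have h1 : ∀ᶠ r : ℝ in nhdsWithin 0 (Set.Ioi 0),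
          ⟪c, y⟫_ℝ + r * ⟪x, y⟫_ℝ ≤ ⟪c, p⟫_ℝ + r * ⟪x, p⟫_ℝ := by
        filter_upwards [eventually_sgn z c x] with r hr
        have : maxFace P (c + r • x) = maxFace P (c + t • x) := (hb _ _).1 (hr.trans hts.symm)
        have h2 := (this ▸ hp : p ∈ maxFace P (c + r • x)).2 y hy
        simpa [inner_add_left, real_inner_smul_left] using h2
      have lim : ∀ w : Euc d, Filter.Tendsto (fun r : ℝ => ⟪c, w⟫_ℝ + r * ⟪x, w⟫_ℝ)
          (nhdsWithin 0 (Set.Ioi 0)) (nhds ⟪c, w⟫_ℝ) := by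
        intro w
        have : ContinuousAt (fun r : ℝ => ⟪c, w⟫_ℝ + r * ⟪x, w⟫_ℝ) 0 := by fun_prop
        have h3 := this.tendsto
        simp only [zero_mul, add_zero] at h3
        exact h3.mono_left nhdsWithin_le_nhds
      exact le_of_tendsto_of_tendsto (lim y) (lim p) h1
    have heq : maxFace P (c + t • x) = maxFace P c := by
      apply Set.Subset.antisymm
      · intro q hq
        refine ⟨hq.1, fun y hy => ?_⟩
        have h1 := maxFace_inner_eq hp hq
        have h2 := hpc.2 y hy
        have h3 := hpc.2 q hq.1
        by_contra hlt
        push Not at hlt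
        -- q maximizes for the same sign cell, hence also in the limit
        have h1' : ∀ᶠ r : ℝ in nhdsWithin 0 (Set.Ioi 0),
            ⟪c, p⟫_ℝ + r * ⟪x, p⟫_ℝ ≤ ⟪c, q⟫_ℝ + r * ⟪x, q⟫_ℝ := by
          filter_upwards [eventually_sgn z c x] with r hr
          have : maxFace P (c + r • x) = maxFace P (c + t • x) := (hb _ _).1 (hr.trans hts.symm)
          have h2 := (this ▸ hq : q ∈ maxFace P (c + r • x)).2 p hp.1
          simpa [inner_add_left, real_inner_smul_left] using h2
        have lim : ∀ w : Euc d, Filter.Tendsto (fun r : ℝ => ⟪c, w⟫_ℝ + r * ⟪x, w⟫_ℝ)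
            (nhdsWithin 0 (Set.Ioi 0)) (nhds ⟪c, w⟫_ℝ) := by
          intro w
          have : ContinuousAt (fun r : ℝ => ⟪c, w⟫_ℝ + r * ⟪x, w⟫_ℝ) 0 := by fun_prop
          have h3 := this.tendsto
          simp only [zero_mul, add_zero] at h3
          exact h3.mono_left nhdsWithin_le_nhds
        have := le_of_tendsto_of_tendsto (lim p) (lim q) h1'
        linarith
      · intro q hq
        refine ⟨hq.1, fun y hy => ?_⟩
        have h1 := hp.2 y hy
        have h2 := maxFace_inner_eq hpc hq
        have h3 := hx p hpc q hq
        simp only [inner_add_left, real_inner_smul_left] at h1 ⊢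
        rw [← h2, ← h3]
        exact h1
    intro i hi
    have h4 := congrFun ((hb _ _).2 heq) i
    rw [hi] at h4
    simp only [sgn, sign_eq_zero_iff, inner_add_right, real_inner_smul_right] at h4 hi
    rw [hi, zero_add] at h4
    exact (mul_eq_zero.1 h4).resolve_left ht0.ne'
  · intro hx
    have ev := (eventually_sgn z c x).and (self_mem_nhdsWithin (a := (0 : ℝ)) (s := Set.Ioi 0))
    obtain ⟨t, hts, ht⟩ := ev.exists
    have ht0 : (0 : ℝ) < t := ht
    have hs : sgn z (c + t • x) = sgn z c := by
      rw [hts]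
      funext i
      by_cases hi : ⟪z i, c⟫_ℝ = 0
      · rw [if_pos hi, hx i (by simp [sgn, hi])]
        simp [sgn, hi]
      · rw [if_neg hi]; rfl
    have hm := (hb _ _).1 hs
    rw [mem_vectorSpan_orth]
    intro p hp q hq
    have h1 := maxFace_inner_eq hp hq
    have h2 := maxFace_inner_eq (hm.symm ▸ hp) (hm.symm ▸ hq)
    simp only [inner_add_left, real_inner_smul_left] at h2
    rw [h1] at h2
    have : t * ⟪x, p⟫_ℝ = t * ⟪x, q⟫_ℝ := by linarith
    exact mul_left_cancel₀ ht0.ne' this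

lemma relPt_mem {d : ℕ} {F : Set (Euc d)} (hc : Convex ℝ F) (hne : F.Nonempty) :
    relPt F ∈ intrinsicInterior ℝ F := by
  have h : (intrinsicInterior ℝ F).Nonempty := hne.intrinsicInterior hc
  rw [relPt, dif_pos h]
  exact h.some_mem

lemma relint_extend {d : ℕ} {F : Set (Euc d)} {q x : Euc d} (hq : q ∈ intrinsicInterior ℝ F)
    (hx : x ∈ F) : ∃ t : ℝ, 0 < t ∧ q + t • (q - x) ∈ F := by
  obtain ⟨y, hy, rfl⟩ := mem_intrinsicInterior.1 hq
  have hmem : ∀ t : ℝ, (y : Euc d) + t • ((y : Euc d) - x) ∈ affineSpan ℝ F := by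
    intro t
    have := AffineMap.lineMap_mem (-t) y.2 (subset_affineSpan ℝ F hx)
    rw [AffineMap.lineMap_apply_module'] at this
    convert this using 1
    module
  let f : ℝ → affineSpan ℝ F := fun t => ⟨_, hmem t⟩
  have hf : Continuous f := by
    apply Continuous.subtype_mk
    fun_prop
  have h0 : f 0 = y := by
    apply Subtype.ext
    simp [f]
  have h1 : ∀ᶠ t in nhds 0, f t ∈ ((↑) ⁻¹' F : Set (affineSpan ℝ F)) := by
    apply hf.continuousAt.eventually_mem
    rw [h0]
    exact mem_interior_iff_mem_nhds.1 hy
  have h2 := h1.filter_mono (nhdsWithin_le_nhds (s := Set.Ioi 0))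
  obtain ⟨t, h, ht⟩ := (h2.and self_mem_nhdsWithin).exists
  exact ⟨t, ht, h⟩

lemma posHull_polytope {d : ℕ} {P : Set (Euc d)} (hP : IsPolytope P) (q : Euc d) :
    IsPolyhedralCone (posHull ((fun x => x - q) '' P)) := by
  classical
  obtain ⟨s, hs, rfl⟩ := hP
  refine ⟨s.card, fun i => (s.equivFin.symm i).1 - q, ?_⟩
  ext u
  constructor
  · rintro ⟨c, _, ⟨p, hp, rfl⟩, hc, rfl⟩
    obtain ⟨w, hw0, hw1, rfl⟩ := Finset.mem_convexHull'.1 hp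
    refine ⟨fun i => c * w (s.equivFin.symm i).1,
      fun i => mul_nonneg hc (hw0 _ (s.equivFin.symm i).2), ?_⟩
    rw [s.equivFin.symm.sum_comp (fun y : s => (c * w y.1) • (y.1 - q)),
      Finset.sum_coe_sort s (fun y => (c * w y) • (y - q))]
    simp only [mul_smul, ← Finset.smul_sum, smul_sub, Finset.sum_sub_distrib, ← Finset.sum_smul,
      hw1, one_smul]
  · rintro ⟨c, hc, rfl⟩
    by_cases hC : ∑ i, c i = 0
    · have h0 : ∀ i, c i = 0 := fun i =>
        (Finset.sum_eq_zero_iff_of_nonneg (fun i _ => hc i)).1 hC i (Finset.mem_univ i)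
      obtain ⟨p, hp⟩ := hs
      exact ⟨0, p - q, ⟨p, subset_convexHull ℝ _ hp, rfl⟩, le_rfl, by simp [h0]⟩
    · have hC0 : 0 < ∑ i, c i := lt_of_le_of_ne (Finset.sum_nonneg fun i _ => hc i) (Ne.symm hC)
      refine ⟨∑ i, c i, _, ⟨∑ i, (c i / ∑ j, c j) • (s.equivFin.symm i).1, ?_, rfl⟩, hC0.le, ?_⟩
      · apply (convex_convexHull ℝ _).sum_mem
        · intro i _; exact div_nonneg (hc i) hC0.le
        · rw [← Finset.sum_div, div_self hC]
        · intro i _; exact subset_convexHull ℝ _ (s.equivFin.symm i).2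
      · rw [smul_sub, Finset.smul_sum]
        simp only [smul_sub, Finset.sum_sub_distrib, smul_smul, ← Finset.sum_smul]
        congr 1
        apply Finset.sum_congr rfl
        intro i _
        rw [mul_div_cancel₀ _ hC]

lemma innerCone_eq {d : ℕ} {P : Set (Euc d)} (htop : vectorSpan ℝ P = ⊤) (F : Set (Euc d)) :
    innerCone F P = posHull ((fun x => x - relPt F) '' P) := by
  rw [innerCone, htop, Submodule.top_orthogonal_eq_bot]
  simp

lemma maxFace_add {d : ℕ} {P : Set (Euc d)} (hP : IsPolytope P) {g c : Euc d}
    (h : maxFace P c ⊆ maxFace P g) {t : ℝ} (ht : 0 < t) :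
    maxFace P (g + t • c) = maxFace P c := by
  apply Set.Subset.antisymm
  · intro p hp
    obtain ⟨q, hq⟩ := maxFace_nonempty hP c
    refine ⟨hp.1, fun y hy => ?_⟩
    have h1 := hp.2 q hq.1
    have h2 := (h hq).2 p hp.1
    have h3 := hq.2 y hy
    simp only [inner_add_left, real_inner_smul_left] at h1
    have h4 : t * ⟪c, q⟫_ℝ ≤ t * ⟪c, p⟫_ℝ := by linarith
    have := le_of_mul_le_mul_left h4 ht
    linarith
  · intro p hp
    refine ⟨hp.1, fun y hy => ?_⟩
    have h1 := hp.2 y hy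
    have h2 := (h hp).2 y hy
    simp only [inner_add_left, real_inner_smul_left]
    nlinarith

lemma mem_innerCone {d : ℕ} {P : Set (Euc d)} (hP : IsPolytope P) (htop : vectorSpan ℝ P = ⊤)
    (c u : Euc d) : u ∈ innerCone (maxFace P c) P ↔
      ∀ c', maxFace P c' = maxFace P c → ⟪c', u⟫_ℝ ≤ 0 := by
  have hq := relPt_mem (maxFace_convex hP.convex c) (maxFace_nonempty hP c)
  rw [innerCone_eq htop]
  set q := relPt (maxFace P c) with hqdef
  have hqF := intrinsicInterior_subset hq
  constructor
  · rintro ⟨a, _, ⟨p, hp, rfl⟩, ha, rfl⟩ c' hc'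
    rw [← hc'] at hqF
    have := hqF.2 p hp
    rw [real_inner_smul_right, inner_sub_right]
    nlinarith
  · intro h
    obtain ⟨G, hG⟩ := (posHull_polytope hP q).exists_Hc
    rw [hG]
    intro g hg
    have hgP : ∀ p ∈ P, ⟪g, p⟫_ℝ ≤ ⟪g, q⟫_ℝ := by
      intro p hp
      have : p - q ∈ posHull ((fun x => x - q) '' P) :=
        ⟨1, p - q, ⟨p, hp, rfl⟩, zero_le_one, by simp⟩
      rw [hG] at this
      have := this g hg
      rw [inner_sub_right] at this
      linarith
    have hsub : maxFace P c ⊆ maxFace P g := by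
      intro x hx
      obtain ⟨t, ht, hm⟩ := relint_extend hq hx
      have h1 := hgP _ hm.1
      rw [inner_add_right, real_inner_smul_right, inner_sub_right] at h1
      refine ⟨hx.1, fun y hy => (hgP y hy).trans ?_⟩
      by_contra hlt
      push Not at hlt
      nlinarith
    by_contra hpos
    push Not at hpos
    have ev := (eventually_sign ⟪g, u⟫_ℝ ⟪c, u⟫_ℝ).and
      (self_mem_nhdsWithin (a := (0 : ℝ)) (s := Set.Ioi 0))
    obtain ⟨t, hts, ht⟩ := ev.exists
    have h1 := h _ (maxFace_add hP hsub ht)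
    rw [if_neg hpos.ne', sign_pos hpos, sign_eq_one_iff] at hts
    rw [inner_add_left, real_inner_smul_left] at h1
    linarith


lemma belt_le_iff {d k : ℕ} {P : Set (Euc d)} {z : Fin k → Euc d} (hP : IsPolytope P)
    (hb : Belt P z) (c0 c : Euc d) :
    vectorSpan ℝ (maxFace P c0) ≤ vectorSpan ℝ (maxFace P c) ↔
      c ∈ (vectorSpan ℝ (maxFace P c0))ᗮ := by
  constructor
  · intro h
    exact Submodule.orthogonal_le h (self_mem_orth P c)
  · intro h
    have h2 : (vectorSpan ℝ (maxFace P c))ᗮ ≤ (vectorSpan ℝ (maxFace P c0))ᗮ := by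
      rw [orth_eq_Wz hP hb] at h ⊢
      rw [orth_eq_Wz hP hb]
      intro x hx
      rw [mem_Wz] at h hx ⊢
      intro i hi
      apply hx i
      rw [sgn, h i hi, sign_zero]
    have h3 := Submodule.orthogonal_le h2
    rwa [Submodule.orthogonal_orthogonal, Submodule.orthogonal_orthogonal] at h3

open Classical in
/-- the face belonging to a sign vector -/
def faceOf {d k : ℕ} (P : Set (Euc d)) (z : Fin k → Euc d) (σ : Fin k → SignType) :
    Set (Euc d) :=
  if h : ∃ c, sgn z c = σ then maxFace P h.choose else ∅

lemma faceOf_sgn {d k : ℕ} {P : Set (Euc d)} {z : Fin k → Euc d} (hb : Belt P z) (c : Euc d) :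
    faceOf P z (sgn z c) = maxFace P c := by
  have h : ∃ c', sgn z c' = sgn z c := ⟨c, rfl⟩
  rw [faceOf, dif_pos h]
  exact (hb _ _).1 h.choose_spec

lemma faces_finite {d k : ℕ} {P : Set (Euc d)} {z : Fin k → Euc d} (hb : Belt P z) :
    {F | ∃ c, F = maxFace P c}.Finite := by
  apply (Set.finite_range (faceOf P z)).subset
  rintro F ⟨c, rfl⟩
  exact ⟨sgn z c, faceOf_sgn hb c⟩

open Classical in
lemma count_zero {d k : ℕ} {P : Set (Euc d)} {z : Fin k → Euc d} (hP : IsPolytope P)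
    (htop : vectorSpan ℝ P = ⊤) (hb : Belt P z) (FF : Finset (Set (Euc d)))
    (hFF : ∀ F, F ∈ FF ↔ ∃ c, F = maxFace P c) (c0 u x0 : Euc d)
    (hx0 : x0 ∈ (vectorSpan ℝ (maxFace P c0))ᗮ) (hu : 0 < ⟪x0, u⟫_ℝ) :
    ∑ F ∈ FF.filter (fun F => vectorSpan ℝ (maxFace P c0) ≤ vectorSpan ℝ F),
      (-1 : ℝ) ^ (d - Module.finrank ℝ (vectorSpan ℝ F)) * ind (innerCone F P) u = 0 := by
  set V := (vectorSpan ℝ (maxFace P c0))ᗮ with hV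
  have e1 := euler_arr k z V Set.univ isOpen_univ convex_univ
  have e2 := euler_arr k z V {x | 0 < ⟪x, u⟫_ℝ} (isOpen_lt (by fun_prop) (by fun_prop)) (by
    intro x hx y hy a b ha hb hab
    simp only [Set.mem_ofPred_eq] at hx hy ⊢
    rw [inner_add_left, real_inner_smul_left, real_inner_smul_left]
    rcases ha.eq_or_lt with rfl | ha
    · have : b = 1 := by linarith
      subst this
      simpa using hy
    · have := mul_pos ha hx
      have := mul_nonneg hb hy.le
      linarith)
  rw [if_pos ⟨x0, hx0, trivial⟩] at e1
  rw [if_pos ⟨x0, hx0, hu⟩] at e2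
  have e3 := sub_eq_zero.2 (e1.trans e2.symm)
  rw [← Finset.sum_sub_distrib] at e3
  rw [← e3]
  symm
  rw [← Finset.sum_filter_add_sum_filter_not Finset.univ
    (fun σ : Fin k → SignType => ∃ x ∈ V, sgn z x = σ)]
  rw [Finset.sum_eq_zero (s := Finset.univ.filter
    (fun σ : Fin k → SignType => ¬ ∃ x ∈ V, sgn z x = σ)), add_zero]
  swap
  · intro σ hσ
    have hσ := (Finset.mem_filter.1 hσ).2
    rw [if_neg, if_neg, sub_zero]
    · rintro ⟨x, hx, -, h⟩
      exact hσ ⟨x, hx, funext h⟩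
    · rintro ⟨x, hx, -, h⟩
      exact hσ ⟨x, hx, funext h⟩
  refine Finset.sum_nbij (faceOf P z) ?_ ?_ ?_ ?_
  · intro σ hσ
    obtain ⟨x, hx, rfl⟩ := (Finset.mem_filter.1 hσ).2
    rw [faceOf_sgn hb, Finset.mem_filter]
    exact ⟨(hFF _).2 ⟨x, rfl⟩, (belt_le_iff hP hb _ _).2 hx⟩
  · intro σ hσ τ hτ h
    obtain ⟨x, hx, rfl⟩ := (Finset.mem_filter.1 hσ).2
    obtain ⟨y, hy, rfl⟩ := (Finset.mem_filter.1 hτ).2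
    rw [faceOf_sgn hb, faceOf_sgn hb] at h
    exact (hb _ _).2 h
  · intro F hF
    obtain ⟨h1, h2⟩ := Finset.mem_filter.1 hF
    obtain ⟨c, rfl⟩ := (hFF _).1 h1
    refine ⟨sgn z c, ?_, faceOf_sgn hb c⟩
    simp only [Finset.coe_filter, Finset.mem_univ, true_and, Set.mem_ofPred_eq]
    exact ⟨c, (belt_le_iff hP hb _ _).1 h2, rfl⟩
  · intro σ hσ
    obtain ⟨x, hx, rfl⟩ := (Finset.mem_filter.1 hσ).2
    rw [faceOf_sgn hb, if_pos ⟨x, hx, trivial, fun i => rfl⟩]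
    have hle : (vectorSpan ℝ (maxFace P x))ᗮ ≤ V :=
      Submodule.orthogonal_le ((belt_le_iff hP hb _ _).2 hx)
    have hW : V ⊓ Wz z (sgn z x) = (vectorSpan ℝ (maxFace P x))ᗮ := by
      rw [← orth_eq_Wz hP hb]
      exact inf_eq_right.2 hle
    have hfin : Module.finrank ℝ ↥(V ⊓ Wz z (sgn z x)) =
        d - Module.finrank ℝ (vectorSpan ℝ (maxFace P x)) := by
      have h1 := congrArg (fun W : Submodule ℝ (Euc d) => Module.finrank ℝ W) hW
      have h2 := Submodule.finrank_add_finrank_orthogonal (vectorSpan ℝ (maxFace P x))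
      rw [finrank_euclideanSpace_fin] at h2
      omega
    rw [hfin]
    by_cases hm : u ∈ innerCone (maxFace P x) P
    · rw [ind, if_pos hm, if_neg]
      · ring
      · rintro ⟨y, -, hy, h⟩
        have := (mem_innerCone hP htop x u).1 hm y ((hb _ _).1 (funext h))
        simp only [Set.mem_ofPred_eq] at hy
        linarith
    · rw [ind, if_neg hm, if_pos]
      · ring
      · rw [mem_innerCone hP htop] at hm
        push Not at hm
        obtain ⟨y, hy, hyu⟩ := hm
        refine ⟨y, ?_, hyu, fun i => congrFun ((hb _ _).2 hy) i⟩
        apply hle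
        rw [← hy]
        exact self_mem_orth P y

open Classical in
/-- Pointwise version of the key lemma. -/
lemma pointwise {d k : ℕ} {P : Set (Euc d)} {z : Fin k → Euc d} (hP : IsPolytope P)
    (htop : vectorSpan ℝ P = ⊤) (hb : Belt P z) (FF : Finset (Set (Euc d)))
    (hFF : ∀ F, F ∈ FF ↔ ∃ c, F = maxFace P c) (u : Euc d)
    (hgen : ∀ L ∈ Flats P, L ≠ ⊤ → ∃ x ∈ Lᗮ, ⟪x, u⟫_ℝ ≠ 0)
    (L top : ↥(Flats P)) (ht : top.1 = ⊤) :
    (∑ F ∈ FF.filter (fun F => vectorSpan ℝ F = L.1), ind (innerCone F P) u) =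
      (-1) ^ (d - Module.finrank ℝ L.1) * mob L top := by
  have hmem : ∀ F ∈ FF, vectorSpan ℝ F ∈ Flats P := by
    intro F hF
    obtain ⟨h1, h2⟩ := (face_iff hP F).2 ((hFF F).1 hF)
    exact ⟨F, h1, h2, rfl⟩
  have hfinite : (Flats P).Finite := by
    apply (FF.finite_toSet.image (fun F => vectorSpan ℝ F)).subset
    rintro L ⟨F, h1, h2, rfl⟩
    exact ⟨F, (hFF F).2 ((face_iff hP F).1 ⟨h1, h2⟩), rfl⟩
  have : Fintype ↥(Flats P) := hfinite.fintype
  let g : ↥(Flats P) → ℝ := fun L' => ∑ F ∈ FF.filter (fun F => vectorSpan ℝ F = L'.1),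
    (-1 : ℝ) ^ (d - Module.finrank ℝ (vectorSpan ℝ F)) * ind (innerCone F P) u
  have hg1 : g top = 1 := by
    have e : FF.filter (fun F => vectorSpan ℝ F = top.1) = {P} := by
      ext F
      rw [Finset.mem_filter, Finset.mem_singleton, ht]
      constructor
      · rintro ⟨h1, h2⟩
        obtain ⟨c, rfl⟩ := (hFF F).1 h1
        have hc := self_mem_orth P c
        rw [h2, Submodule.top_orthogonal_eq_bot, Submodule.mem_bot] at hc
        rw [hc, maxFace_zero]
      · rintro rfl
        exact ⟨(hFF _).2 ⟨0, (maxFace_zero _).symm⟩, htop⟩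
    have hin : u ∈ innerCone P P := by
      have h0 := mem_innerCone hP htop 0 u
      rw [maxFace_zero] at h0
      rw [h0]
      intro c' hc'
      have := self_mem_orth P c'
      rw [hc', htop, Submodule.top_orthogonal_eq_bot, Submodule.mem_bot] at this
      simp [this]
    have hfd : Module.finrank ℝ (vectorSpan ℝ P) = d := by
      rw [htop, finrank_top, finrank_euclideanSpace_fin]
    simp only [g]
    rw [e, Finset.sum_singleton, ind, if_pos hin, hfd]
    simp
  have hg2 : ∀ a ≠ top, ∑ b ∈ Finset.univ.filter (fun b => a ≤ b), g b = 0 := by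
    intro a ha
    have hane : a.1 ≠ ⊤ := fun h => ha (Subtype.ext (h.trans ht.symm))
    obtain ⟨x, hx, hxu⟩ := hgen a.1 a.2 hane
    obtain ⟨x0, hx0, hx0u⟩ : ∃ x0 ∈ (a.1)ᗮ, 0 < ⟪x0, u⟫_ℝ := by
      rcases lt_or_gt_of_ne hxu with h | h
      · exact ⟨-x, neg_mem hx, by rw [inner_neg_left]; linarith⟩
      · exact ⟨x, hx, h⟩
    obtain ⟨F0, h1, h2, h3⟩ := a.2
    obtain ⟨c0, rfl⟩ := (face_iff hP F0).1 ⟨h1, h2⟩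
    rw [h3] at hx0
    rw [← count_zero hP htop hb FF hFF c0 u x0 hx0 hx0u]
    let φ : Set (Euc d) → ↥(Flats P) := fun F =>
      if h : vectorSpan ℝ F ∈ Flats P then ⟨vectorSpan ℝ F, h⟩ else top
    have hφ : ∀ F ∈ FF, (φ F).1 = vectorSpan ℝ F := by
      intro F hF
      simp only [φ]
      rw [dif_pos (hmem F hF)]
    rw [← Finset.sum_fiberwise_of_maps_to (t := Finset.univ.filter (fun b => a ≤ b)) (g := φ)]
    · apply Finset.sum_congr rfl
      intro b hb'
      have hab : a.1 ≤ b.1 := (Finset.mem_filter.1 hb').2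
      simp only [g]
      apply Finset.sum_congr _ (fun _ _ => rfl)
      ext F
      simp only [Finset.mem_filter]
      constructor
      · rintro ⟨hF, e⟩
        refine ⟨⟨hF, ?_⟩, Subtype.ext ((hφ F hF).trans e)⟩
        rw [e, ← h3]; exact hab
      · rintro ⟨⟨hF, _⟩, e⟩
        exact ⟨hF, (hφ F hF).symm.trans (congrArg Subtype.val e)⟩
    · intro F hF
      obtain ⟨hF, hle⟩ := Finset.mem_filter.1 hF
      rw [Finset.mem_filter]
      refine ⟨Finset.mem_univ _, ?_⟩
      change a.1 ≤ (φ F).1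
      rw [hφ F hF, h3]
      exact hle
  have hmob := mob_unique top g hg1 hg2 L
  rw [← hmob]
  simp only [g]
  rw [Finset.mul_sum]
  apply Finset.sum_congr rfl
  intro F hF
  rw [(Finset.mem_filter.1 hF).2, ← mul_assoc, ← mul_pow]
  norm_num

lemma Hc_filter {d : ℕ} (G : Finset (Euc d)) [DecidablePred fun g : Euc d => g ≠ 0] :
    Hc (G.filter (fun g => g ≠ 0)) = Hc G := by
  ext x
  constructor
  · intro h g hg
    by_cases h0 : g = 0
    · simp [h0]
    · exact h g (Finset.mem_filter.2 ⟨hg, h0⟩)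
  · intro h g hg
    exact h g (Finset.mem_filter.1 hg).1

/-- Key Lemma.
Let `P ⊂ ℝ^d` be a `d`-dimensional belt polytope with lattice of flats `L(P)` (whose
maximum `top` is `ℝ^d = L(P)`), and let `α` be any cone angle. For any fixed flat `L`:
`Σ_{F : L(F) = L} α̂(F,P) = (-1)^{d - dim L} μ_{L(P)}(L, 1̂)`. -/
theorem statement7 (d : ℕ) (hd : 0 < d) (α : ConeAngle d) (P : Set (Euc d))
    (hP : IsBeltPolytope P) (hdim : sdim P = d)
    (L : ↥(Flats P)) (top : ↥(Flats P)) (htop : top.1 = vectorSpan ℝ P) :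
    (∑ᶠ F ∈ {F : Set (Euc d) | IsFace P F ∧ F.Nonempty ∧ vectorSpan ℝ F = L.1},
        intAngle α F P) =
      (-1) ^ (d - Module.finrank ℝ L.1) * mob L top := by
  classical
  obtain ⟨hpoly, k, z, -, hz⟩ := hP
  have hb : Belt P z := by
    intro c c'
    rw [← hz]
    constructor
    · intro h i
      exact (real_sign_eq_iff _ _).2 (congrFun h i)
    · intro h
      exact funext fun i => (real_sign_eq_iff _ _).1 (h i)
  have hT : vectorSpan ℝ P = ⊤ := by
    apply Submodule.eq_top_of_finrank_eq
    rw [finrank_euclideanSpace_fin]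
    exact hdim
  have hfin := faces_finite hb
  set FF := hfin.toFinset with hFFdef
  have hFF : ∀ F, F ∈ FF ↔ ∃ c, F = maxFace P c := fun F => hfin.mem_toFinset
  have hc : ∀ F, ∃ c, F ∈ FF → F = maxFace P c := by
    intro F
    by_cases h : F ∈ FF
    · obtain ⟨c, hc⟩ := (hFF F).1 h
      exact ⟨c, fun _ => hc⟩
    · exact ⟨0, fun h' => absurd h' h⟩
  choose cF hcF using hc
  have hG : ∀ F, ∃ G : Finset (Euc d), innerCone F P = Hc G := by
    intro F
    rw [innerCone_eq hT]
    exact (posHull_polytope hpoly _).exists_Hc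
  choose GF hGF using hG
  let A : Finset (Euc d) := (FF.image cF ∪ FF.biUnion GF).filter (fun g => g ≠ 0)
  obtain ⟨ι, _, u, w, -, hgen, hrep⟩ :=
    angle_rep α A (fun a ha => (Finset.mem_filter.1 ha).2) ∅
  have hw : ∑ i, w i = 1 := by
    have h := hrep ∅ (Finset.empty_subset _)
    have e : Hc (∅ : Finset (Euc d)) = Set.univ := by
      ext x; simp [Hc]
    rw [Finset.empty_union, e, α.norm'] at h
    rw [h]
    apply Finset.sum_congr rfl
    intro i _
    simp [ind]
  have hang : ∀ F ∈ FF, intAngle α F P = ∑ i, w i * ind (innerCone F P) (u i) := by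
    intro F hF
    have h := hrep ((GF F).filter (fun g => g ≠ 0)) (by
      apply Finset.filter_subset_filter
      intro g hg
      exact Finset.mem_union_right _ (Finset.mem_biUnion.2 ⟨F, hF, hg⟩))
    rw [Finset.empty_union, Hc_filter, ← hGF] at h
    exact h
  have hpt : ∀ i, (∑ F ∈ FF.filter (fun F => vectorSpan ℝ F = L.1),
      ind (innerCone F P) (u i)) = (-1) ^ (d - Module.finrank ℝ L.1) * mob L top := by
    intro i
    apply pointwise hpoly hT hb FF hFF (u i) _ L top (htop.trans hT)
    rintro L' ⟨F, h1, h2, rfl⟩ hne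
    have hF : F ∈ FF := (hFF F).2 ((face_iff hpoly F).1 ⟨h1, h2⟩)
    have hFc := hcF F hF
    refine ⟨cF F, ?_, ?_⟩
    · have := self_mem_orth P (cF F)
      rwa [← hFc] at this
    · apply hgen i
      refine Finset.mem_filter.2 ⟨Finset.mem_union_left _ (Finset.mem_image_of_mem _ hF), ?_⟩
      intro h0
      apply hne
      rw [hFc, h0, maxFace_zero, hT]
  have hset : {F : Set (Euc d) | IsFace P F ∧ F.Nonempty ∧ vectorSpan ℝ F = L.1} =
      ↑(FF.filter (fun F => vectorSpan ℝ F = L.1)) := by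
    ext F
    rw [Finset.mem_coe, Finset.mem_filter, hFF, ← face_iff hpoly F, Set.mem_ofPred_eq, and_assoc]
  rw [hset, finsum_mem_coe_finset]
  rw [Finset.sum_congr rfl (fun F hF => hang F (Finset.mem_filter.1 hF).1), Finset.sum_comm]
  simp only [← Finset.mul_sum]
  rw [Finset.sum_congr rfl (fun i _ => congrArg (w i * ·) (hpt i)), ← Finset.sum_mul, hw, one_mul]

end GramAngles
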